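/- arXiv:1305.3793 — 6 statements merged into one kernel-verified Lean document; each statement's English description precedes it below -/
import Mathlib

section
/- Let a > 0 and let x : (−a, 0) → (0, ∞) be a differentiable function satisfying the Bernoulli equation x'(F) + (π/a)·cot((π/a)·F)·x(F) − (π/a)·cot((π/a)·F)·x(F)³ = 0 for all F ∈ (−a, 0). Then there exists a constant c₀ ∈ ℝ such that x(F)^{−2} = 1 + c₀·sin²((π/a)·F) for all F ∈ (−a, 0). -/
open Real Set Filter Topology

/-- Along a solution `x` of the Bernoulli equation `x' + k cot(kF) x - k cot(kF) x³ = 0`, the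
quantity `(x⁻² - 1) / sin²(kF)` is a first integral. -/
lemma hasDerivAt_bernoulli_first_integral {k F : ℝ} {x : ℝ → ℝ} (hx : x F ≠ 0)
    (hs : Real.sin (k * F) ≠ 0) (hd : DifferentiableAt ℝ x F)
    (hode : deriv x F + k * Real.cot (k * F) * x F - k * Real.cot (k * F) * (x F) ^ 3 = 0) :
    HasDerivAt (fun t => (((x t) ^ 2)⁻¹ - 1) / (Real.sin (k * t)) ^ 2) 0 F := by
  have hsin : HasDerivAt (fun t => Real.sin (k * t)) (Real.cos (k * F) * k) F := by
    simpa using ((hasDerivAt_id F).const_mul k).sin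
  have hquot := (((hd.hasDerivAt.fun_pow 2).fun_inv (pow_ne_zero 2 hx)).sub_const 1).fun_div
    (hsin.fun_pow 2) (pow_ne_zero 2 hs)
  refine hquot.congr_deriv ?_
  have hx' : deriv x F = k * Real.cot (k * F) * ((x F) ^ 3 - x F) := by linear_combination hode
  rw [hx', Real.cot_eq_cos_div_sin]
  field_simp
  ring

theorem stmt_2 (a : ℝ) (ha : 0 < a) (x : ℝ → ℝ)
    (hpos : ∀ F ∈ Ioo (-a) (0:ℝ), 0 < x F)
    (hdiff : ∀ F ∈ Ioo (-a) (0:ℝ), DifferentiableAt ℝ x F)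
    (hode : ∀ F ∈ Ioo (-a) (0:ℝ),
      deriv x F + π / a * Real.cot (π / a * F) * x F -
        π / a * Real.cot (π / a * F) * (x F) ^ 3 = 0) :
    ∃ c₀ : ℝ, ∀ F ∈ Ioo (-a) (0:ℝ),
      ((x F) ^ 2)⁻¹ = 1 + c₀ * (Real.sin (π / a * F)) ^ 2 := by
  have hsin : ∀ F ∈ Ioo (-a) (0:ℝ), Real.sin (π / a * F) ≠ 0 := by
    intro F hF
    have hk : 0 < π / a := div_pos pi_pos ha
    refine (sin_neg_of_neg_of_neg_pi_lt (mul_neg_of_pos_of_neg hk hF.2) ?_).ne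
    calc -π = π / a * (-a) := by field_simp
      _ < π / a * F := mul_lt_mul_of_pos_left hF.1 hk
  have hderiv := fun F hF => hasDerivAt_bernoulli_first_integral (hpos F hF).ne' (hsin F hF)
    (hdiff F hF) (hode F hF)
  obtain ⟨c₀, hc₀⟩ := isOpen_Ioo.exists_is_const_of_deriv_eq_zero isPreconnected_Ioo
    (fun F hF => (hderiv F hF).differentiableAt.differentiableWithinAt)
    (fun F hF => (hderiv F hF).deriv)
  refine ⟨c₀, fun F hF => ?_⟩
  have h := (div_eq_iff (pow_ne_zero 2 (hsin F hF))).mp (hc₀ F hF)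
  linear_combination h
end

section
/- Let a > 0 and let F : (0,1) → (−a, 0) be a C² function with F'(r) > 0 for all r ∈ (0,1) satisfying F''(r) + F'(r)/r − (π/a)·cot((π/a)·F(r))·F'(r)² + (1/r²)·(π/a)·cot((π/a)·F(r)) = 0 on (0,1). Then there exists a constant c₀ ∈ ℝ with 1 + c₀·sin²((π/a)·F(r)) > 0 for all r ∈ (0,1), such that for all r₁, r₂ ∈ (0,1): ln(r₂) − ln(r₁) = ∫_{F(r₁)}^{F(r₂)} (1 + c₀·sin²((π/a)·t))^{−1/2} dt. -/
open Real Set Filter Topology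

/-- `((r F')² - 1) / sin² (k F)` is a first integral of the reduced harmonic map equation. -/
theorem hasDerivAt_firstIntegral {k r F₁ F₂ : ℝ} {F : ℝ → ℝ} (hr : r ≠ 0)
    (hs : Real.sin (k * F r) ≠ 0) (hF : HasDerivAt F F₁ r) (hF₁ : deriv F r = F₁)
    (hF₂ : HasDerivAt (deriv F) F₂ r)
    (hode : F₂ + F₁ / r - k * Real.cot (k * F r) * F₁ ^ 2 +
      1 / r ^ 2 * (k * Real.cot (k * F r)) = 0) :
    HasDerivAt (fun x => ((x * deriv F x) ^ 2 - 1) / Real.sin (k * F x) ^ 2) 0 r := by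
  have hnum := (((hasDerivAt_id r).mul hF₂).pow 2).sub_const 1
  have hden := ((hF.const_mul k).sin).pow 2
  refine (hnum.div hden (pow_ne_zero 2 hs)).congr_deriv ?_
  have hF₂' : F₂ = -(F₁ / r) + k * Real.cot (k * F r) * F₁ ^ 2 -
      1 / r ^ 2 * (k * Real.cot (k * F r)) := by linarith
  simp only [Pi.mul_apply, Pi.pow_apply, id_eq, hF₁, hF₂', Real.cot_eq_cos_div_sin]
  field_simp
  ring

theorem stmt_3 (a : ℝ) (ha : 0 < a) (F : ℝ → ℝ)
    (hC2 : ContDiffOn ℝ 2 F (Ioo 0 1))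
    (hmem : ∀ r ∈ Ioo (0:ℝ) 1, F r ∈ Ioo (-a) 0)
    (hF' : ∀ r ∈ Ioo (0:ℝ) 1, 0 < deriv F r)
    (hode : ∀ r ∈ Ioo (0:ℝ) 1,
      deriv (deriv F) r + deriv F r / r -
        π / a * Real.cot (π / a * F r) * (deriv F r) ^ 2 +
        1 / r ^ 2 * (π / a * Real.cot (π / a * F r)) = 0) :
    ∃ c₀ : ℝ,
      (∀ r ∈ Ioo (0:ℝ) 1, 0 < 1 + c₀ * (Real.sin (π / a * F r)) ^ 2) ∧
      (∀ r₁ ∈ Ioo (0:ℝ) 1, ∀ r₂ ∈ Ioo (0:ℝ) 1,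
        Real.log r₂ - Real.log r₁ =
          ∫ t in (F r₁)..(F r₂),
            (Real.sqrt (1 + c₀ * (Real.sin (π / a * t)) ^ 2))⁻¹) := by
  have hsin : ∀ r ∈ Ioo (0:ℝ) 1, Real.sin (π / a * F r) ≠ 0 := by
    intro r hr
    obtain ⟨h1, h2⟩ := hmem r hr
    refine (Real.sin_neg_of_neg_of_neg_pi_lt (mul_neg_of_pos_of_neg (by positivity) h2) ?_).ne
    calc -π = π / a * (-a) := by field_simp
      _ < π / a * F r := mul_lt_mul_of_pos_left h1 (by positivity)
  have hF1 : ∀ r ∈ Ioo (0:ℝ) 1, HasDerivAt F (deriv F r) r := fun r hr =>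
    ((hC2.differentiableOn (by norm_num)).differentiableAt (isOpen_Ioo.mem_nhds hr)).hasDerivAt
  have hC1 : ContDiffOn ℝ 1 (deriv F) (Ioo 0 1) :=
    ((contDiffOn_succ_iff_deriv_of_isOpen (n := 1) isOpen_Ioo).1
      (by simpa [one_add_one_eq_two] using hC2)).2.2
  have hF2 : ∀ r ∈ Ioo (0:ℝ) 1, HasDerivAt (deriv F) (deriv (deriv F) r) r := fun r hr =>
    ((hC1.differentiableOn (by norm_num)).differentiableAt (isOpen_Ioo.mem_nhds hr)).hasDerivAt
  have hH := fun r hr => hasDerivAt_firstIntegral (ne_of_gt (mem_Ioo.1 hr).1) (hsin r hr)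
    (hF1 r hr) rfl (hF2 r hr) (hode r hr)
  obtain ⟨c₀, hc₀⟩ := isOpen_Ioo.exists_is_const_of_deriv_eq_zero isPreconnected_Ioo
    (fun r hr => (hH r hr).differentiableAt.differentiableWithinAt) (fun r hr => (hH r hr).deriv)
  have hsq : ∀ r ∈ Ioo (0:ℝ) 1, 1 + c₀ * Real.sin (π / a * F r) ^ 2 = (r * deriv F r) ^ 2 := by
    intro r hr
    have := (div_eq_iff (pow_ne_zero 2 (hsin r hr))).1 (hc₀ r hr)
    linarith
  have hpos : ∀ r ∈ Ioo (0:ℝ) 1, 0 < r * deriv F r := fun r hr => mul_pos hr.1 (hF' r hr)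
  have hpos' : ∀ r ∈ Ioo (0:ℝ) 1, 0 < 1 + c₀ * Real.sin (π / a * F r) ^ 2 := fun r hr =>
    hsq r hr ▸ pow_pos (hpos r hr) 2
  refine ⟨c₀, hpos', fun r₁ h₁ r₂ h₂ => ?_⟩
  have hsub : uIcc r₁ r₂ ⊆ Ioo 0 1 := ordConnected_Ioo.uIcc_subset h₁ h₂
  have hcont : ContinuousOn (fun t => (Real.sqrt (1 + c₀ * Real.sin (π / a * t) ^ 2))⁻¹)
      (F '' uIcc r₁ r₂) := by
    refine ContinuousOn.inv₀ (by fun_prop) ?_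
    rintro _ ⟨r, hr, rfl⟩
    exact (Real.sqrt_pos.2 (hpos' r (hsub hr))).ne'
  rw [← intervalIntegral.integral_comp_mul_deriv' (fun r hr => hF1 r (hsub hr))
    (hC1.continuousOn.mono hsub) hcont, ← Real.log_div h₂.1.ne' h₁.1.ne',
    ← integral_inv_of_pos h₁.1 h₂.1]
  refine intervalIntegral.integral_congr fun r hr => ?_
  have hr' := hsub hr
  have := (hF' r hr').ne'
  have := hr'.1.ne'
  simp only [Function.comp_apply, hsq r hr', Real.sqrt_sq (hpos r hr').le]
  field_simp
end

section
/- There is no differentiable function H : (0,1) → (0, ∞) satisfying the Riccati equation H'(r) + H(r)² + H(r)/r = 1/r² for all r ∈ (0,1), except H(r) = 1/r; that is, any positive differentiable solution H of this equation on (0,1) satisfies H(r) = 1/r for all r ∈ (0,1). -/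
open Real Set Filter Topology

/-- Along a positive solution of the Riccati equation, `r² (r H - 1) / (r H + 1)` is a
first integral. -/
lemma hasDerivAt_riccati_first_integral {H : ℝ → ℝ} {r : ℝ} (hr : 0 < r) (hpos : 0 < H r)
    (hdiff : DifferentiableAt ℝ H r)
    (hode : deriv H r + (H r) ^ 2 + H r / r = 1 / r ^ 2) :
    HasDerivAt (fun x => x ^ 2 * (x * H x - 1) / (x * H x + 1)) 0 r := by
  have hne : r * H r + 1 ≠ 0 := by positivity
  have hu := (hasDerivAt_id' r).fun_mul hdiff.hasDerivAt
  refine (((hasDerivAt_pow 2 r).fun_mul (hu.sub_const 1)).fun_div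
    (hu.add_const 1) hne).congr_deriv ?_
  have hd : deriv H r = 1 / r ^ 2 - H r ^ 2 - H r / r := by linarith
  rw [hd]
  field_simp
  ring

theorem stmt_8 (H : ℝ → ℝ)
    (hpos : ∀ r ∈ Ioo (0:ℝ) 1, 0 < H r)
    (hdiff : ∀ r ∈ Ioo (0:ℝ) 1, DifferentiableAt ℝ H r)
    (hode : ∀ r ∈ Ioo (0:ℝ) 1,
      deriv H r + (H r) ^ 2 + H r / r = 1 / r ^ 2) :
    ∀ r ∈ Ioo (0:ℝ) 1, H r = 1 / r := by
  intro r hr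
  set w : ℝ → ℝ := fun x => x ^ 2 * (x * H x - 1) / (x * H x + 1) with hw
  have hderiv : ∀ x ∈ Ioo (0:ℝ) 1, HasDerivAt w 0 x := fun x hx =>
    hasDerivAt_riccati_first_integral hx.1 (hpos x hx) (hdiff x hx) (hode x hx)
  have hconst : ∀ s ∈ Ioo (0:ℝ) 1, w r = w s := fun s hs =>
    isOpen_Ioo.is_const_of_deriv_eq_zero isPreconnected_Ioo
      (fun x hx => (hderiv x hx).differentiableAt.differentiableWithinAt)
      (fun x hx => (hderiv x hx).deriv) hr hs
  have hbound : ∀ s ∈ Ioo (0:ℝ) 1, |w r| ≤ s ^ 2 := by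
    intro s hs
    have hu : 0 < s * H s := mul_pos hs.1 (hpos s hs)
    rw [hconst s hs, hw, abs_div, abs_mul, abs_of_pos (by positivity : 0 < s * H s + 1),
      abs_of_nonneg (sq_nonneg s), div_le_iff₀ (by positivity)]
    gcongr
    rw [abs_le]
    constructor <;> linarith
  have hzero : w r = 0 := by
    by_contra hne
    have h0 : 0 < |w r| := abs_pos.mpr hne
    have h1 : |w r| < 1 := (hbound r hr).trans_lt (by nlinarith [hr.1, hr.2])
    nlinarith [hbound _ ⟨h0, h1⟩]
  have hr0 : r ≠ 0 := hr.1.ne'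
  have hne : r * H r + 1 ≠ 0 := by
    have := mul_pos hr.1 (hpos r hr)
    positivity
  have hu : r * H r - 1 = 0 := by simpa [hw, hr0, hne] using hzero
  rw [eq_div_iff hr0]
  linarith
end

section
/- Let a > 0 and define q : (e^{-a}, 1) → ℝ by q(r) = (e^{2a}·r² − 1) / ( r·(e^{2a} − 1) ). Then q satisfies q''(r) + q'(r)/r − q(r)/r² = 0 and q'(r) > 0 for all r ∈ (e^{-a}, 1), with lim_{r→e^{-a}⁺} q(r) = 0 and lim_{r→1⁻} q(r) = 1; in particular q maps (e^{-a}, 1) strictly increasingly onto (0,1). -/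
open Real Set Filter Topology

/-- The derivative of `r ↦ (E r² - 1) / (r (E - 1))` away from the origin. -/
theorem hasDerivAt_radialProfile {E r : ℝ} (hE : 1 < E) (hr : r ≠ 0) :
    HasDerivAt (fun r : ℝ => (E * r ^ 2 - 1) / (r * (E - 1)))
      ((E + (r ^ 2)⁻¹) / (E - 1)) r := by
  have hE' : E - 1 ≠ 0 := (sub_pos.2 hE).ne'
  have h := (((hasDerivAt_pow 2 r).const_mul E).sub_const 1).div
    ((hasDerivAt_id r).mul_const (E - 1)) (mul_ne_zero hr hE')
  refine h.congr_deriv ?_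
  simp only [id]
  field_simp
  ring

/-- The derivative of `r ↦ (E + r⁻²) / (E - 1)` away from the origin. -/
theorem hasDerivAt_deriv_radialProfile {E r : ℝ} (hr : r ≠ 0) :
    HasDerivAt (fun r : ℝ => (E + (r ^ 2)⁻¹) / (E - 1)) (-2 / r ^ 3 / (E - 1)) r := by
  have h := (((hasDerivAt_pow 2 r).inv (pow_ne_zero 2 hr)).const_add E).div_const (E - 1)
  refine h.congr_deriv ?_
  congr 1
  field_simp
  push_cast
  ring

theorem stmt_9 (a : ℝ) (ha : 0 < a)
    (q : ℝ → ℝ)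
    (hq : ∀ r : ℝ, q r = (Real.exp (2 * a) * r ^ 2 - 1) / (r * (Real.exp (2 * a) - 1))) :
    (∀ r ∈ Ioo (Real.exp (-a)) 1,
      deriv (deriv q) r + deriv q r / r - q r / r ^ 2 = 0) ∧
    (∀ r ∈ Ioo (Real.exp (-a)) 1, 0 < deriv q r) ∧
    Tendsto q (𝓝[>] (Real.exp (-a))) (𝓝 0) ∧
    Tendsto q (𝓝[<] (1:ℝ)) (𝓝 1) ∧
    StrictMonoOn q (Ioo (Real.exp (-a)) 1) ∧
    q '' Ioo (Real.exp (-a)) 1 = Ioo 0 1 := by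
  have hE : 1 < Real.exp (2 * a) := Real.one_lt_exp_iff.2 (by linarith)
  have hs : 0 < Real.exp (-a) := Real.exp_pos _
  have hs1 : Real.exp (-a) < 1 := Real.exp_lt_one_iff.2 (by linarith)
  have hEs : Real.exp (2 * a) * Real.exp (-a) ^ 2 = 1 := by
    rw [← Real.exp_nat_mul, ← Real.exp_add, ← Real.exp_zero]
    congr 1
    push_cast
    ring
  generalize Real.exp (2 * a) = E at *
  generalize Real.exp (-a) = s at *
  obtain rfl : q = fun r => (E * r ^ 2 - 1) / (r * (E - 1)) := funext hq
  clear hq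
  set q : ℝ → ℝ := fun r => (E * r ^ 2 - 1) / (r * (E - 1)) with hq
  have hE' : 0 < E - 1 := sub_pos.2 hE
  have hd : ∀ r, r ≠ 0 → HasDerivAt q ((E + (r ^ 2)⁻¹) / (E - 1)) r :=
    fun r hr => hasDerivAt_radialProfile hE hr
  have hd2 : ∀ r, r ≠ 0 → deriv (deriv q) r = -2 / r ^ 3 / (E - 1) := by
    intro r hr
    have h : deriv q =ᶠ[𝓝 r] fun r => (E + (r ^ 2)⁻¹) / (E - 1) := by
      filter_upwards [isOpen_ne.mem_nhds hr] with x hx using (hd x hx).deriv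
    rw [h.deriv_eq, (hasDerivAt_deriv_radialProfile hr).deriv]
  have hpos : ∀ r ∈ Ioo s 1, 0 < deriv q r := by
    intro r hr
    have hr0 : 0 < r := hs.trans hr.1
    rw [(hd r hr0.ne').deriv]
    positivity
  have hqs : q s = 0 := by simp [hq, hEs]
  have hq1 : q 1 = 1 := by simp [hq, hE'.ne']
  have hcont : ContinuousOn q (Icc s 1) := fun r hr =>
    (hd r (hs.trans_le hr.1).ne').continuousAt.continuousWithinAt
  have hmono : StrictMonoOn q (Icc s 1) :=
    strictMonoOn_of_deriv_pos (convex_Icc s 1) hcont (by rwa [interior_Icc])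
  refine ⟨?_, hpos, ?_, ?_, hmono.mono Ioo_subset_Icc_self, Subset.antisymm ?_ ?_⟩
  · intro r hr
    have hr0 : r ≠ 0 := (hs.trans hr.1).ne'
    rw [hd2 r hr0, (hd r hr0).deriv]
    simp only [hq]
    have := hE'.ne'
    field_simp
    ring
  · simpa only [hqs] using (hd s hs.ne').continuousAt.tendsto.mono_left nhdsWithin_le_nhds
  · simpa only [hq1] using (hd 1 one_ne_zero).continuousAt.tendsto.mono_left nhdsWithin_le_nhds
  · rintro _ ⟨r, hr, rfl⟩
    have hr' := Ioo_subset_Icc_self hr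
    exact ⟨hqs ▸ hmono (left_mem_Icc.2 hs1.le) hr' hr.1,
      hq1 ▸ hmono hr' (right_mem_Icc.2 hs1.le) hr.2⟩
  · simpa only [hqs, hq1] using intermediate_value_Ioo hs1.le hcont
end

section
/- Let v : (0,1) → (0, ∞) be a differentiable function satisfying (1 − k²)·v'(k) − 2k·v(k) + (k + k³)·v(k)³ = 0 for all k ∈ (0,1). Then there exists a constant c₅ ≥ 0 such that v(k)^{−2} = k² + c₅·(1 − k²)² for all k ∈ (0,1). -/
open Real Set Filter Topology

/-- The quantity `(v⁻² - k²) / (1 - k²)²` is a first integral of the equation. -/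
lemma hasDerivAt_firstIntegral_s11 {v : ℝ → ℝ} {k : ℝ} (hk : k ∈ Ioo (0:ℝ) 1)
    (hv : 0 < v k) (hd : DifferentiableAt ℝ v k)
    (hode : (1 - k ^ 2) * deriv v k - 2 * k * v k + (k + k ^ 3) * (v k) ^ 3 = 0) :
    HasDerivAt (fun x => (((v x) ^ 2)⁻¹ - x ^ 2) / (1 - x ^ 2) ^ 2) 0 k := by
  have h1 : 1 - k ^ 2 ≠ 0 := by nlinarith [hk.1, hk.2]
  have hv0 : v k ≠ 0 := hv.ne'
  have hnum := ((hd.hasDerivAt.pow 2).inv (pow_ne_zero 2 hv0)).sub ((hasDerivAt_id k).pow 2)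
  have hden := (((hasDerivAt_id k).pow 2).const_sub 1).pow 2
  have hq := hnum.div hden (pow_ne_zero 2 h1)
  have hderiv : deriv v k = (2 * k * v k - (k + k ^ 3) * (v k) ^ 3) / (1 - k ^ 2) := by
    rw [eq_div_iff h1]
    linear_combination hode
  refine hq.congr_deriv ?_
  rw [hderiv]
  simp only [Pi.pow_apply, Pi.sub_apply, Pi.inv_apply, id_eq]
  field_simp
  ring

/-- If `k² + c (1 - k²)²` is positive on `(0, 1)`, then `c` is nonnegative. -/
lemma nonneg_of_forall_sq_add_mul_pos {c : ℝ}
    (h : ∀ k ∈ Ioo (0:ℝ) 1, 0 < k ^ 2 + c * (1 - k ^ 2) ^ 2) : 0 ≤ c := by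
  have hlim : Tendsto (fun k : ℝ => k ^ 2 + c * (1 - k ^ 2) ^ 2) (𝓝[>] 0) (𝓝 c) := by
    have hc : Continuous fun k : ℝ => k ^ 2 + c * (1 - k ^ 2) ^ 2 := by fun_prop
    simpa using (hc.tendsto 0).mono_left nhdsWithin_le_nhds
  refine ge_of_tendsto hlim ?_
  filter_upwards [Ioo_mem_nhdsGT (zero_lt_one' ℝ)] with k hk
  exact (h k hk).le

theorem stmt_11 (v : ℝ → ℝ)
    (hpos : ∀ k ∈ Ioo (0:ℝ) 1, 0 < v k)
    (hdiff : ∀ k ∈ Ioo (0:ℝ) 1, DifferentiableAt ℝ v k)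
    (hode : ∀ k ∈ Ioo (0:ℝ) 1,
      (1 - k ^ 2) * deriv v k - 2 * k * v k + (k + k ^ 3) * (v k) ^ 3 = 0) :
    ∃ c₅ : ℝ, 0 ≤ c₅ ∧ ∀ k ∈ Ioo (0:ℝ) 1,
      ((v k) ^ 2)⁻¹ = k ^ 2 + c₅ * (1 - k ^ 2) ^ 2 := by
  have hd := fun k hk => hasDerivAt_firstIntegral_s11 hk (hpos k hk) (hdiff k hk) (hode k hk)
  obtain ⟨c, hc⟩ := isOpen_Ioo.exists_is_const_of_deriv_eq_zero isPreconnected_Ioo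
    (fun k hk => (hd k hk).differentiableAt.differentiableWithinAt) (fun k hk => (hd k hk).deriv)
  have hsol : ∀ k ∈ Ioo (0:ℝ) 1, ((v k) ^ 2)⁻¹ = k ^ 2 + c * (1 - k ^ 2) ^ 2 := by
    intro k hk
    have h1 : 1 - k ^ 2 ≠ 0 := by nlinarith [hk.1, hk.2]
    have h := hc k hk
    rw [div_eq_iff (pow_ne_zero 2 h1)] at h
    linear_combination h
  refine ⟨c, nonneg_of_forall_sq_add_mul_pos fun k hk => ?_, hsol⟩
  rw [← hsol k hk]
  exact inv_pos.2 (pow_pos (hpos k hk) 2)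
end

section
/- Let w : (0,1) → ℝ be a differentiable function satisfying the linear equation w'(k) + (4k/(1 − k²))·w(k) = 2(k + k³)/(1 − k²) for all k ∈ (0,1). Then there exists a constant c ∈ ℝ such that w(k) = k² + c·(1 − k²)² for all k ∈ (0,1). -/
open Real Set Filter Topology

theorem stmt_12 (w : ℝ → ℝ)
    (hdiff : ∀ k ∈ Ioo (0:ℝ) 1, DifferentiableAt ℝ w k)
    (hode : ∀ k ∈ Ioo (0:ℝ) 1,
      deriv w k + 4 * k / (1 - k ^ 2) * w k = 2 * (k + k ^ 3) / (1 - k ^ 2)) :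
    ∃ c : ℝ, ∀ k ∈ Ioo (0:ℝ) 1, w k = k ^ 2 + c * (1 - k ^ 2) ^ 2 := by
  have hne : ∀ k ∈ Ioo (0:ℝ) 1, 1 - k ^ 2 ≠ 0 := fun k hk => by nlinarith [hk.1, hk.2]
  have hquot : ∀ k ∈ Ioo (0:ℝ) 1,
      HasDerivAt (fun x => (w x - x ^ 2) / (1 - x ^ 2) ^ 2) 0 k := fun k hk => by
    have h0 := hne k hk
    have hsq : HasDerivAt (fun x : ℝ => x ^ 2) (2 * k) k := by simpa using hasDerivAt_pow 2 k
    have h := ((hdiff k hk).hasDerivAt.sub hsq).div ((hsq.const_sub 1).pow 2)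
      (pow_ne_zero 2 h0)
    refine h.congr_deriv ?_
    have e := hode k hk
    field_simp at e
    simp only [Pi.sub_apply, Pi.pow_apply]
    rw [div_eq_zero_iff]
    left
    push_cast
    linear_combination (1 - k ^ 2) * e
  obtain ⟨c, hc⟩ := isOpen_Ioo.exists_is_const_of_deriv_eq_zero isPreconnected_Ioo
    (fun k hk => (hquot k hk).differentiableAt.differentiableWithinAt)
    (fun k hk => (hquot k hk).deriv)
  refine ⟨c, fun k hk => ?_⟩
  have h := (div_eq_iff (pow_ne_zero 2 (hne k hk))).mp (hc k hk)
  linear_combination h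
end
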